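/- Let B̄_{k,i}(n,j,p) be the number of overpartitions of n with j overlined parts and p parts, in which λ_ℓ − λ_{ℓ+k−1} ≥ 1 if λ_{ℓ+k−1} is overlined and λ_ℓ − λ_{ℓ+k−1} ≥ 2 otherwise, and at most i−1 parts equal 1, and set 𝓑_{k,i}(a,x,q) = Σ_{n,j,p≥0} B̄_{k,i}(n,j,p) a^j x^p q^n. Then for all 1 ≤ i ≤ k, 𝓑_{k,i}(a,x,q) = J_{k,i}(−a,x,q). -/

import Mathlib

namespace Paper

/-- An overpartition is represented as a list of pairs `(part, overlined?)`.
Parts are positive, the list is non-increasing in the part sizes, and among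
equal parts only the final occurrence may be overlined. -/
def IsOverpartition (l : List (ℕ × Bool)) : Prop :=
  (∀ p ∈ l, 1 ≤ p.1) ∧
  l.Chain' fun x y => y.1 < x.1 ∨ (x.1 = y.1 ∧ x.2 = false)

/-- The weight of an overpartition: the sum of its parts. -/
def opWeight (l : List (ℕ × Bool)) : ℕ := (l.map Prod.fst).sum

/-- The number of overlined parts. -/
def opOverlined (l : List (ℕ × Bool)) : ℕ := (l.filter fun p => p.2).length

/-- The difference condition of Gordon type: `λ_ℓ - λ_{ℓ+k-1} ≥ 1` if `λ_{ℓ+k-1}` is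
overlined and `λ_ℓ - λ_{ℓ+k-1} ≥ 2` otherwise (indices `0`-based). -/
def GapCond (k : ℕ) (l : List (ℕ × Bool)) : Prop :=
  ∀ m : ℕ, m + (k - 1) < l.length →
    (l.getD (m + (k - 1)) (0, false)).1 +
      (if (l.getD (m + (k - 1)) (0, false)).2 then 1 else 2) ≤ (l.getD m (0, false)).1

/-- Overpartitions counted by `B̄_{k,i}`: the Gordon difference condition holds and at
most `i - 1` parts are equal to `1`. -/
def BCond (k i : ℕ) (l : List (ℕ × Bool)) : Prop :=
  IsOverpartition l ∧ GapCond k l ∧ (l.filter fun p => p.1 == 1).length ≤ i - 1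

/-- `Bbar k i n j` : the number of overpartitions of `n` with `j` overlined parts
satisfying the `B̄_{k,i}` conditions. -/
noncomputable def Bbar (k i n j : ℕ) : ℕ :=
  Nat.card {l : List (ℕ × Bool) //
    BCond k i l ∧ opWeight l = n ∧ opOverlined l = j}

/-- The Frobenius representation of an overpartition: a two-rowed array whose top row
is a partition into distinct nonnegative parts and whose bottom row is an
overpartition into nonnegative parts where the first occurrence of a part may be
overlined. -/
structure FrobSym : Type where
  top : List ℕ
  bot : List (ℕ × Bool)
  top_sorted : top.Chain' (· > ·)
  bot_sorted : bot.Chain' fun x y => y.1 < x.1 ∨ (x.1 = y.1 ∧ y.2 = false)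
  len_eq : top.length = bot.length

/-- The number of columns of a Frobenius symbol. -/
def frobCols (F : FrobSym) : ℕ := F.top.length

/-- The weight of the overpartition represented by a Frobenius symbol. -/
def frobWeight (F : FrobSym) : ℕ :=
  F.top.length + F.top.sum + (F.bot.map Prod.fst).sum

/-- The number of non-overlined parts in the bottom row. -/
def botNonOverlined (F : FrobSym) : ℕ := (F.bot.filter fun p => !p.2).length

/-- The number of overlined parts in the bottom row. -/
def botOverlined (F : FrobSym) : ℕ := (F.bot.filter fun p => p.2).length

/-- The `m`-th successive rank (0-based): `a_m - b_m` minus the number of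
non-overlined parts among `b_{m+1}, …, b_N`. -/
def frobRank (F : FrobSym) (m : ℕ) : ℤ :=
  (F.top.getD m 0 : ℤ) - ((F.bot.getD m (0, false)).1 : ℤ) -
    (((F.bot.drop (m + 1)).filter fun p => !p.2).length : ℤ)

/-- All successive ranks lie in the interval `[-i+2, 2k-i-1]`. -/
def RankCond (k i : ℕ) (F : FrobSym) : Prop :=
  ∀ m : ℕ, m < F.top.length →
    -(i : ℤ) + 2 ≤ frobRank F m ∧ frobRank F m ≤ 2 * (k : ℤ) - i - 1

/-- `Cbar k i n j` : the number of overpartitions of `n` (counted through their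
Frobenius representation) with `j` non-overlined parts in the bottom row and all
successive ranks in `[-i+2, 2k-i-1]`. -/
noncomputable def Cbar (k i n j : ℕ) : ℕ :=
  Nat.card {F : FrobSym //
    frobWeight F = n ∧ botNonOverlined F = j ∧ RankCond k i F}

/-- The list of overlined parts (in order). -/
def olList (l : List (ℕ × Bool)) : List ℕ := (l.filter fun p => p.2).map Prod.fst

/-- The list of non-overlined parts (in order). -/
def nolList (l : List (ℕ × Bool)) : List ℕ := (l.filter fun p => !p.2).map Prod.fst

/-- The size of the generalized Durfee square: the largest `N` such that the number of
overlined parts plus the number of non-overlined parts `≥ N` is at least `N`. -/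
noncomputable def genDurfeeSize (l : List (ℕ × Bool)) : ℕ :=
  Nat.findGreatest
    (fun N => N ≤ (olList l).length + ((nolList l).filter fun p => decide (N ≤ p)).length)
    l.length

/-- The size of the generalized Durfee rectangle: the largest `N` such that the number
of overlined parts plus the number of non-overlined parts `≥ N + 1` is at least `N`. -/
noncomputable def genDurfeeRectSize (l : List (ℕ × Bool)) : ℕ :=
  Nat.findGreatest
    (fun N => N ≤ (olList l).length + ((nolList l).filter fun p => decide (N + 1 ≤ p)).length)
    l.length

/-- The (ordinary) partition lying below the first generalized Durfee square/rectangle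
of size `N`, when the overlined parts are displayed above the non-overlined ones. -/
def belowGen (l : List (ℕ × Bool)) (N : ℕ) : List ℕ :=
  (nolList l).drop (N - (olList l).length)

/-- The size of the Durfee square of an ordinary partition. -/
noncomputable def durfeeSquareSize (μ : List ℕ) : ℕ :=
  Nat.findGreatest (fun d => d ≤ (μ.filter fun p => decide (d ≤ p)).length) μ.length

/-- The size of the `d × (d+1)` Durfee rectangle of an ordinary partition. -/
noncomputable def durfeeRectSize (μ : List ℕ) : ℕ :=
  Nat.findGreatest (fun d => d ≤ (μ.filter fun p => decide (d + 1 ≤ p)).length) μ.length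

/-- Remove `m` successive Durfee squares. -/
noncomputable def dissectSquares : ℕ → List ℕ → List ℕ
  | 0, μ => μ
  | m + 1, μ => dissectSquares m (μ.drop (durfeeSquareSize μ))

/-- Remove `m` successive Durfee rectangles. -/
noncomputable def dissectRects : ℕ → List ℕ → List ℕ
  | 0, μ => μ
  | m + 1, μ => dissectRects m (μ.drop (durfeeRectSize μ))

/-- The overpartition has `i - 1` successive Durfee squares followed by `k - i`
successive Durfee rectangles, the first one being a generalized
Durfee square (if `i ≥ 2`) or a generalized Durfee rectangle (if `i = 1`). -/
noncomputable def DurfeeCond (k i : ℕ) (l : List (ℕ × Bool)) : Prop :=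
  if 2 ≤ i then
    dissectRects (k - i) (dissectSquares (i - 2) (belowGen l (genDurfeeSize l))) = []
  else
    dissectRects (k - 2) (belowGen l (genDurfeeRectSize l)) = []

/-- `Dbar k i n j` : the number of overpartitions of `n` with `j` overlined parts and
`i-1` successive Durfee squares followed by `k-i` successive Durfee rectangles, the
first one being a generalized Durfee square/rectangle. -/
noncomputable def Dbar (k i n j : ℕ) : ℕ :=
  Nat.card {l : List (ℕ × Bool) //
    IsOverpartition l ∧ opWeight l = n ∧ opOverlined l = j ∧ DurfeeCond k i l}


open scoped Classical

/-- The infinite q-Pochhammer symbol `(x;q)_∞ = ∏_{i≥0} (1 - x qⁱ)`. -/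
noncomputable def qPochInf (x q : ℂ) : ℂ := ∏' i : ℕ, (1 - x * q ^ i)

/-- The finite q-Pochhammer symbol `(x;q)_N = ∏_{i=0}^{N-1} (1 - x qⁱ)`. -/
noncomputable def qPochN (x q : ℂ) (N : ℕ) : ℂ := ∏ i ∈ Finset.range N, (1 - x * q ^ i)

/-- The q-Pochhammer symbol with arbitrary integer index,
`(x;q)_n = (x;q)_∞ / (x qⁿ;q)_∞`. -/
noncomputable def qPochZ (x q : ℂ) (n : ℤ) : ℂ := qPochInf x q / qPochInf (x * q ^ n) q


/-- Andrews' function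
`H_{k,i}(a,x,q) = Σ_{n≥0} x^{kn} q^{kn²+n-in} aⁿ (1-xⁱq^{2ni}) (axq^{n+1};q)_∞ (1/a;q)_n
                   / ((q;q)_n (xqⁿ;q)_∞)`. -/
noncomputable def Hgf (k i : ℕ) (a x q : ℂ) : ℂ :=
  ∑' n : ℕ, x ^ (k * n) * q ^ ((k : ℤ) * (n : ℤ) ^ 2 + (n : ℤ) - (i : ℤ) * (n : ℤ)) *
    a ^ n * (1 - x ^ i * q ^ (2 * n * i)) * qPochInf (a * x * q ^ (n + 1)) q *
    qPochN (1 / a) q n / (qPochN q q n * qPochInf (x * q ^ n) q)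

/-- Andrews' function `J_{k,i}(a,x,q) = H_{k,i}(a,xq,q) - axq H_{k,i-1}(a,xq,q)`. -/
noncomputable def Jgf (k i : ℕ) (a x q : ℂ) : ℂ :=
  Hgf k i a (x * q) q - a * x * q * Hgf k (i - 1) a (x * q) q

/-- `BbarP k i n j p` : the number of overpartitions of `n` with `j` overlined parts
and `p` parts satisfying the `B̄_{k,i}` conditions. -/
noncomputable def BbarP (k i n j p : ℕ) : ℕ :=
  Nat.card {l : List (ℕ × Bool) //
    BCond k i l ∧ opWeight l = n ∧ opOverlined l = j ∧ l.length = p}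

/-- The overpartition obtained from `l` by adding one to every part and then appending `m`
non-overlined ones and, if `b` holds, one overlined one. -/
def glueOnes (l : List (ℕ × Bool)) (m : ℕ) (b : Bool) : List (ℕ × Bool) :=
  l.map (fun p => (p.1 + 1, p.2)) ++
    (List.replicate m (1, false) ++ List.replicate b.toNat (1, true))

theorem length_glueOnes (l : List (ℕ × Bool)) (m : ℕ) (b : Bool) :
    (glueOnes l m b).length = l.length + (m + b.toNat) := by
  simp [glueOnes]

theorem opWeight_glueOnes (l : List (ℕ × Bool)) (m : ℕ) (b : Bool) :
    opWeight (glueOnes l m b) = opWeight l + l.length + (m + b.toNat) := by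
  have h : ∀ l : List (ℕ × Bool),
      (l.map (Prod.fst ∘ fun p => (p.1 + 1, p.2))).sum = (l.map Prod.fst).sum + l.length := by
    intro l
    induction l with
    | nil => simp
    | cons p l ih => simp [ih]; omega
  simp [glueOnes, opWeight, h]

theorem opOverlined_glueOnes (l : List (ℕ × Bool)) (m : ℕ) (b : Bool) :
    opOverlined (glueOnes l m b) = opOverlined l + b.toNat := by
  simp [glueOnes, opOverlined, List.filter_map, Function.comp_def]

theorem count_ones_glueOnes {l : List (ℕ × Bool)} (hl : ∀ p ∈ l, 1 ≤ p.1) (m : ℕ) (b : Bool) :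
    ((glueOnes l m b).filter fun p => p.1 == 1).length = m + b.toNat := by
  have h : (l.filter fun p => p.1 == 0) = [] := by
    simp only [List.filter_eq_nil_iff, beq_iff_eq]
    intro p hp
    have := hl p hp
    omega
  simp [glueOnes, List.filter_map, Function.comp_def, h]

theorem forall_le_glueOnes {l : List (ℕ × Bool)} {m N : ℕ} {b : Bool}
    (h : ∀ p ∈ glueOnes l m b, p.1 ≤ N + 1) : ∀ p ∈ l, p.1 ≤ N := by
  intro p hp
  have := h (p.1 + 1, p.2) (by
    simp only [glueOnes, List.mem_append, List.mem_map]
    exact Or.inl ⟨p, hp, rfl⟩)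
  simpa using this

theorem IsOverpartition.glueOnes {l : List (ℕ × Bool)} (hl : IsOverpartition l) (m : ℕ)
    (b : Bool) : IsOverpartition (glueOnes l m b) := by
  obtain ⟨hpos, hchain⟩ := hl
  refine ⟨?_, ?_⟩
  · intro p hp
    simp only [Paper.glueOnes, List.mem_append, List.mem_map, List.mem_replicate] at hp
    rcases hp with ⟨p, -, rfl⟩ | ⟨-, rfl⟩ | ⟨-, rfl⟩ <;> simp
  · refine List.IsChain.append ?_ ?_ ?_
    · rw [List.isChain_map]
      exact List.IsChain.imp (fun x y h => by simpa using h) hchain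
    · refine List.IsChain.append ?_ ?_ ?_
      · exact List.isChain_replicate_of_rel _ (Or.inr ⟨rfl, rfl⟩)
      · cases b <;> simp
      · intro x hx y hy
        have hx := List.mem_of_getLast? hx
        have hy := List.mem_of_head? hy
        simp only [List.mem_replicate] at hx hy
        simp [hx.2, hy.2]
    · intro x hx y hy
      have hx := List.mem_of_getLast? hx
      have hy := List.mem_of_head? hy
      simp only [List.mem_append, List.mem_map, List.mem_replicate] at hx hy
      obtain ⟨p, hp, rfl⟩ := hx
      have := hpos p hp
      left
      rcases hy with ⟨-, rfl⟩ | ⟨-, rfl⟩ <;> simp <;> omega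

theorem IsOverpartition.exists_glueOnes {l : List (ℕ × Bool)} (hl : IsOverpartition l) :
    ∃ l' m b, IsOverpartition l' ∧ Paper.glueOnes l' m b = l := by
  induction l with
  | nil => exact ⟨[], 0, false, hl, rfl⟩
  | cons p l ih =>
    obtain ⟨hpos, hchain⟩ := hl
    obtain ⟨hhead, htail⟩ := List.isChain_cons.1 hchain
    obtain ⟨l', m, b, hl', rfl⟩ := ih ⟨fun r hr => hpos r (by simp [hr]), htail⟩
    obtain ⟨v, c⟩ := p
    have hv : 1 ≤ v := hpos (v, c) (by simp)
    obtain hv1 | hv1 := hv.lt_or_eq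
    · refine ⟨(v - 1, c) :: l', m, b, ⟨?_, ?_⟩, ?_⟩
      · intro r hr
        rcases List.mem_cons.1 hr with rfl | hr
        · exact Nat.le_sub_one_of_lt hv1
        · exact hl'.1 r hr
      · refine List.isChain_cons.2 ⟨?_, hl'.2⟩
        intro y hy
        have := hhead (y.1 + 1, y.2) (by
          cases l' with
          | nil => simp at hy
          | cons z l' =>
            simp only [List.head?_cons, Option.mem_def, Option.some.injEq] at hy
            simp [Paper.glueOnes, hy])
        simp only at this ⊢
        exact this.imp (fun h => by omega) (fun h => ⟨by omega, h.2⟩)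
      · simp only [Paper.glueOnes, List.map_cons, List.cons_append]
        rw [Nat.sub_add_cancel hv]
    · subst hv1
      have hnil : l' = [] := by
        cases l' with
        | nil => rfl
        | cons z l' =>
          have h1 := hhead (z.1 + 1, z.2) (by simp [Paper.glueOnes])
          have h2 := hl'.1 z (by simp)
          simp only at h1
          omega
      subst hnil
      cases c with
      | false =>
        exact ⟨[], m + 1, b, hl', by simp [Paper.glueOnes, List.replicate_succ]⟩
      | true =>
        refine ⟨[], 0, true, hl', ?_⟩
        cases m with
        | zero =>
          cases b with
          | false => simp [Paper.glueOnes]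
          | true =>
            have h1 := hhead (1, true) (by simp [Paper.glueOnes])
            simp at h1
        | succ m =>
          have h1 := hhead (1, false) (by simp [Paper.glueOnes, List.replicate_succ])
          simp at h1

theorem glueOnes_inj {l l' : List (ℕ × Bool)} {m m' : ℕ} {b b' : Bool}
    (hl : ∀ p ∈ l, 1 ≤ p.1) (hl' : ∀ p ∈ l', 1 ≤ p.1)
    (h : glueOnes l m b = glueOnes l' m' b') : l = l' ∧ m = m' ∧ b = b' := by
  have hcount := congrArg (fun l => (l.filter fun p => p.1 == 1).length) h
  have hlen := congrArg List.length h
  simp only [count_ones_glueOnes hl, count_ones_glueOnes hl', length_glueOnes] at hcount hlen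
  obtain ⟨h1, h2⟩ := List.append_inj h (by simp; omega)
  have hb := congrArg (fun l => (l.filter fun p => p.2).length) h2
  simp only [List.filter_append, List.length_append, List.filter_replicate] at hb
  refine ⟨List.map_injective_iff.2 ?_ h1, ?_⟩
  · rintro ⟨a, b⟩ ⟨c, d⟩ h
    simpa using h
  · have hb' : b.toNat = b'.toNat := by simpa using hb
    refine ⟨by omega, ?_⟩
    revert hb'
    cases b <;> cases b' <;> simp

theorem getD_glueOnes (l : List (ℕ × Bool)) (m : ℕ) (b : Bool) (n : ℕ) :
    (glueOnes l m b).getD n (0, false) =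
      if n < l.length then ((l.getD n (0, false)).1 + 1, (l.getD n (0, false)).2)
      else if n < l.length + m then (1, false)
      else if n < l.length + (m + b.toNat) then (1, true) else (0, false) := by
  simp only [glueOnes, List.getD_eq_getElem?_getD, List.getElem?_append, List.length_map,
    List.length_replicate, List.getElem?_map, List.getElem?_replicate]
  split_ifs <;> first | omega | simp_all

/-- In an overpartition the parts equal to one occupy the final positions. -/
theorem IsOverpartition.two_le_getD_iff {l : List (ℕ × Bool)} (hl : IsOverpartition l) (n : ℕ) :
    2 ≤ (l.getD n (0, false)).1 ↔ n + (l.filter fun p => p.1 == 1).length < l.length := by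
  obtain ⟨l', m, b, hl', rfl⟩ := hl.exists_glueOnes
  rw [count_ones_glueOnes hl'.1, length_glueOnes, getD_glueOnes]
  have hpos : n < l'.length → 1 ≤ (l'.getD n (0, false)).1 := by
    intro h
    rw [List.getD_eq_getElem _ _ h]
    exact hl'.1 _ (List.getElem_mem h)
  split_ifs with h1 h2 h3
  · have := hpos h1
    simp only
    omega
  all_goals
    simp only
    omega

theorem IsOverpartition.count_ones_lt {k : ℕ} (hk : 1 ≤ k) {l : List (ℕ × Bool)}
    (hl : IsOverpartition l) (hgap : GapCond k l) :
    (l.filter fun p => p.1 == 1).length < k := by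
  by_contra hcon
  have hle := List.length_filter_le (fun p : ℕ × Bool => p.1 == 1) l
  have h1 := hgap (l.length - (l.filter fun p => p.1 == 1).length) (by omega)
  have h2 := (hl.two_le_getD_iff (l.length - (l.filter fun p => p.1 == 1).length)).not.2 (by omega)
  have h3 : 1 ≤ (l.getD (l.length - (l.filter fun p => p.1 == 1).length + (k - 1))
      (0, false)).1 := by
    rw [List.getD_eq_getElem _ _ (by omega)]
    exact hl.1 _ (List.getElem_mem _)
  split_ifs at h1 <;> omega

theorem gapCond_glueOnes_iff {k : ℕ} (hk : 1 ≤ k) {l : List (ℕ × Bool)}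
    (hl : IsOverpartition l) (m : ℕ) (b : Bool) :
    GapCond k (glueOnes l m b) ↔
      GapCond k l ∧ (l.filter fun p => p.1 == 1).length + m < k ∧ m + b.toNat < k := by
  have hle := List.length_filter_le (fun p : ℕ × Bool => p.1 == 1) l
  have hpos : ∀ n, n < l.length → 1 ≤ (l.getD n (0, false)).1 := by
    intro n h
    rw [List.getD_eq_getElem _ _ h]
    exact hl.1 _ (List.getElem_mem h)
  constructor
  · intro h
    have hgap : GapCond k l := by
      intro n hn
      have := h n (by rw [length_glueOnes]; omega)
      rw [getD_glueOnes, getD_glueOnes, if_pos hn,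
        if_pos (show n < l.length by omega)] at this
      simp only at this
      omega
    have hcount := (hl.glueOnes m b).count_ones_lt hk h
    rw [count_ones_glueOnes hl.1] at hcount
    refine ⟨hgap, ?_, hcount⟩
    have hlt := hl.count_ones_lt hk hgap
    by_contra hcon
    have h1 := h (l.length + m - k) (by rw [length_glueOnes]; omega)
    rw [getD_glueOnes, getD_glueOnes, if_neg (by omega), if_pos (by omega),
      if_pos (show l.length + m - k < l.length by omega)] at h1
    have h2 := (hl.two_le_getD_iff (l.length + m - k)).1 (by simpa using h1)
    omega
  · rintro ⟨hgap, hones, hm⟩ n hn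
    rw [length_glueOnes] at hn
    rw [getD_glueOnes, getD_glueOnes]
    by_cases h1 : n + (k - 1) < l.length
    · rw [if_pos h1, if_pos (show n < l.length by omega)]
      have := hgap n h1
      simp only
      omega
    · by_cases h2 : n + (k - 1) < l.length + m
      · rw [if_neg h1, if_pos h2, if_pos (show n < l.length by omega)]
        have := (hl.two_le_getD_iff n).2 (by omega)
        simpa using this
      · have := hpos n (by omega)
        rw [if_neg h1, if_neg h2, if_pos hn, if_pos (show n < l.length by omega)]
        simpa using this

theorem bCond_glueOnes_iff {k i : ℕ} (hi : 1 ≤ i) (hik : i ≤ k) {l : List (ℕ × Bool)}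
    (hl : IsOverpartition l) (m : ℕ) (b : Bool) :
    BCond k i (glueOnes l m b) ↔ m + b.toNat < i ∧ BCond k (k - m) l := by
  rw [BCond, BCond, gapCond_glueOnes_iff (by omega) hl, count_ones_glueOnes hl.1]
  have := hl.glueOnes m b
  constructor
  · rintro ⟨-, ⟨h1, h2, h3⟩, h4⟩
    exact ⟨by omega, hl, h1, by omega⟩
  · rintro ⟨h1, -, h2, h3⟩
    exact ⟨this, ⟨h2, by omega, by omega⟩, by omega⟩

/-- Every overpartition arises uniquely by gluing ones to a shifted overpartition. -/
noncomputable def glueOnesEquiv :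
    {l // IsOverpartition l} × ℕ × Bool ≃ {l // IsOverpartition l} :=
  Equiv.ofBijective (fun t => ⟨glueOnes t.1.1 t.2.1 t.2.2, t.1.2.glueOnes _ _⟩) <| by
    constructor
    · rintro ⟨⟨l, hl⟩, m, b⟩ ⟨⟨l', hl'⟩, m', b'⟩ h
      obtain ⟨rfl, rfl, rfl⟩ := glueOnes_inj hl.1 hl'.1 (congrArg Subtype.val h)
      rfl
    · rintro ⟨l, hl⟩
      obtain ⟨l', m, b, hl', rfl⟩ := hl.exists_glueOnes
      exact ⟨(⟨l', hl'⟩, m, b), rfl⟩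

theorem coe_glueOnesEquiv (t : {l // IsOverpartition l} × ℕ × Bool) :
    (glueOnesEquiv t).1 = glueOnes t.1.1 t.2.1 t.2.2 :=
  rfl

theorem isOverpartition_nil : IsOverpartition [] :=
  ⟨by simp, List.IsChain.nil⟩

/-- The monomial recording the overlined parts, the parts and the weight of an overpartition. -/
def opTerm {R : Type*} [CommSemiring R] (a x q : R) (l : List (ℕ × Bool)) : R :=
  a ^ opOverlined l * x ^ l.length * q ^ opWeight l

theorem opTerm_glueOnes {R : Type*} [CommSemiring R] (a x q : R) (l : List (ℕ × Bool)) (m : ℕ)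
    (b : Bool) :
    opTerm a x q (glueOnes l m b) =
      a ^ b.toNat * (x * q) ^ (m + b.toNat) * opTerm a (x * q) q l := by
  simp only [opTerm, length_glueOnes, opWeight_glueOnes, opOverlined_glueOnes]
  ring

theorem opTerm_nonneg {a x q : ℝ} (ha : 0 ≤ a) (hx : 0 ≤ x) (hq : 0 ≤ q) (l : List (ℕ × Bool)) :
    0 ≤ opTerm a x q l := by
  unfold opTerm
  positivity

theorem norm_opTerm (a x q : ℂ) (l : List (ℕ × Bool)) :
    ‖opTerm a x q l‖ = opTerm ‖a‖ ‖x‖ ‖q‖ l := by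
  simp [opTerm]

theorem one_add_mul_geom_le_exp {a y X : ℝ} (hy : 0 ≤ y) (hyX : y ≤ X) (hX : X < 1) :
    (1 + a * y) * (1 - y)⁻¹ ≤ Real.exp ((a + (1 - X)⁻¹) * y) := by
  have h1 : 1 + a * y ≤ Real.exp (a * y) := by
    have := Real.add_one_le_exp (a * y)
    linarith
  have h2 : (1 - y)⁻¹ ≤ Real.exp ((1 - X)⁻¹ * y) := by
    have h3 : (1 - y)⁻¹ = (1 - y)⁻¹ * y + 1 := by
      have : 1 - y ≠ 0 := by linarith
      field_simp
      ring_nf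
    have h4 : (1 - y)⁻¹ * y ≤ (1 - X)⁻¹ * y := by
      gcongr
    have := Real.add_one_le_exp ((1 - X)⁻¹ * y)
    linarith
  rw [add_mul a, Real.exp_add]
  have : 0 ≤ (1 - y)⁻¹ := inv_nonneg.2 (by linarith)
  gcongr

theorem sum_opTerm_le_exp {a q X : ℝ} (ha : 0 ≤ a) (hq : 0 ≤ q) (hq1 : q < 1) (hX : X < 1)
    (N : ℕ) : ∀ x : ℝ, 0 ≤ x → x ≤ X → ∀ S : Finset {l // IsOverpartition l},
      (∀ l ∈ S, ∀ p ∈ l.1, p.1 ≤ N) →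
        ∑ l ∈ S, opTerm a x q l.1 ≤ Real.exp ((a + (1 - X)⁻¹) * x * (1 - q)⁻¹) := by
  induction N with
  | zero =>
    intro x hx hxX S hS
    have hc : 0 ≤ (1 - X)⁻¹ := inv_nonneg.2 (by linarith)
    have hd : 0 ≤ (1 - q)⁻¹ := inv_nonneg.2 (by linarith)
    set E : Finset {l // IsOverpartition l} := {⟨[], isOverpartition_nil⟩} with hE
    have hsub : S ⊆ E := by
      intro l hl
      rw [hE, Finset.mem_singleton, Subtype.ext_iff]
      rw [List.eq_nil_iff_forall_not_mem]
      intro p hp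
      have h1 := hS l hl p hp
      have h2 := l.2.1 p hp
      omega
    calc ∑ l ∈ S, opTerm a x q l.1
        ≤ ∑ l ∈ E, opTerm a x q l.1 :=
          Finset.sum_le_sum_of_subset_of_nonneg hsub fun l _ _ => opTerm_nonneg ha hx hq l.1
      _ = 1 := by simp [hE, opTerm, opOverlined, opWeight]
      _ ≤ _ := Real.one_le_exp (by positivity)
  | succ N ih =>
    intro x hx hxX S hS
    set T := S.map glueOnesEquiv.symm.toEmbedding with hT
    have hxq : x * q ≤ x := mul_le_of_le_one_right hx hq1.le
    have hxq0 : 0 ≤ x * q := mul_nonneg hx hq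
    have hxq1 : x * q < 1 := by linarith
    have hsum : ∑ l ∈ S, opTerm a x q l.1 =
        ∑ t ∈ T, opTerm a x q (glueOnesEquiv t).1 := by
      simp [hT]
    have hTS : ∀ t ∈ T, glueOnesEquiv t ∈ S := by
      intro t ht
      obtain ⟨l, hl, rfl⟩ := Finset.mem_map.1 ht
      simpa using hl
    have hsub : T ⊆ (T.image Prod.fst) ×ˢ (T.image fun t => t.2.1) ×ˢ Finset.univ := by
      intro t ht
      simp only [Finset.mem_product, Finset.mem_image, Finset.mem_univ, and_true]
      exact ⟨⟨t, ht, rfl⟩, ⟨t, ht, rfl⟩⟩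
    have hterm : ∀ t, opTerm a x q (glueOnesEquiv t).1 =
        opTerm a (x * q) q t.1.1 * ((x * q) ^ t.2.1 * (a * (x * q)) ^ t.2.2.toNat) := by
      intro t
      rw [coe_glueOnesEquiv, opTerm_glueOnes]
      ring
    have hgeom : ∑ m ∈ T.image (fun t => t.2.1), (x * q) ^ m ≤ (1 - x * q)⁻¹ := by
      rw [← tsum_geometric_of_lt_one hxq0 hxq1]
      exact (summable_geometric_of_lt_one hxq0 hxq1).sum_le_tsum _ fun m _ => by positivity
    have hprev := ih (x * q) hxq0 (hxq.trans hxX) (T.image Prod.fst) (by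
      intro l hl
      obtain ⟨t, ht, rfl⟩ := Finset.mem_image.1 hl
      exact forall_le_glueOnes (hS _ (hTS t ht)))
    have hfac : 0 ≤ 1 + a * (x * q) := by positivity
    calc ∑ l ∈ S, opTerm a x q l.1
        ≤ ∑ t ∈ (T.image Prod.fst) ×ˢ (T.image fun t => t.2.1) ×ˢ Finset.univ,
            opTerm a x q (glueOnesEquiv t).1 := by
          rw [hsum]
          exact Finset.sum_le_sum_of_subset_of_nonneg hsub fun t _ _ => opTerm_nonneg ha hx hq _
      _ = (∑ l ∈ T.image Prod.fst, opTerm a (x * q) q l.1) *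
            ((1 + a * (x * q)) * ∑ m ∈ T.image (fun t => t.2.1), (x * q) ^ m) := by
          simp only [hterm]
          rw [Finset.sum_product, Finset.sum_mul]
          refine Finset.sum_congr rfl fun l _ => ?_
          rw [Finset.sum_product, Finset.mul_sum, Finset.mul_sum]
          refine Finset.sum_congr rfl fun m _ => ?_
          simp only [Fintype.sum_bool, Bool.toNat_true, Bool.toNat_false]
          ring
      _ ≤ Real.exp ((a + (1 - X)⁻¹) * (x * q) * (1 - q)⁻¹) *
            ((1 + a * (x * q)) * (1 - x * q)⁻¹) := by
          have : 0 ≤ (1 - x * q)⁻¹ := inv_nonneg.2 (by linarith)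
          gcongr
      _ ≤ Real.exp ((a + (1 - X)⁻¹) * (x * q) * (1 - q)⁻¹) *
            Real.exp ((a + (1 - X)⁻¹) * (x * q)) := by
          gcongr
          exact one_add_mul_geom_le_exp hxq0 (hxq.trans hxX) hX
      _ ≤ _ := by
          rw [← Real.exp_add, Real.exp_le_exp]
          have hc : 0 ≤ a + (1 - X)⁻¹ := add_nonneg ha (inv_nonneg.2 (by linarith))
          have h1 : (1 - q)⁻¹ = q * (1 - q)⁻¹ + 1 := by
            have : 1 - q ≠ 0 := by linarith
            field_simp
            ring
          have h2 : (a + (1 - X)⁻¹) * (x * q) ≤ (a + (1 - X)⁻¹) * x := by gcongr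
          calc _ ≤ (a + (1 - X)⁻¹) * (x * q) * (1 - q)⁻¹ + (a + (1 - X)⁻¹) * x := by linarith
            _ = (a + (1 - X)⁻¹) * x * (q * (1 - q)⁻¹ + 1) := by ring
            _ = _ := by rw [← h1]

theorem summable_opTerm_norm {a x q : ℂ} (hq1 : ‖q‖ < 1) (hx : ‖x‖ < 1) :
    Summable fun l : {l // IsOverpartition l} => ‖opTerm a x q l.1‖ := by
  refine summable_of_sum_le (c := Real.exp ((‖a‖ + (1 - ‖x‖)⁻¹) * ‖x‖ * (1 - ‖q‖)⁻¹))
    (fun _ => norm_nonneg _) fun S => ?_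
  simp only [norm_opTerm]
  refine sum_opTerm_le_exp (norm_nonneg a) (norm_nonneg q) hq1 hx
    (S.sup fun l => (l.1.map Prod.fst).sum) ‖x‖ (norm_nonneg x) le_rfl S ?_
  intro l hl p hp
  exact (List.single_le_sum (fun _ _ => Nat.zero_le _) _ (List.mem_map_of_mem hp)).trans
    (Finset.le_sup (f := fun l : {l // IsOverpartition l} => (l.1.map Prod.fst).sum) hl)

/-- The generating function of the overpartitions satisfying `BCond k i`, as a sum over
overpartitions. -/
noncomputable def bSum (k i : ℕ) (a x q : ℂ) : ℂ :=
  ∑' l : {l // IsOverpartition l}, if BCond k i l.1 then opTerm a x q l.1 else 0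

theorem norm_ite_opTerm_le (k i : ℕ) (a x q : ℂ) (l : List (ℕ × Bool)) :
    ‖if BCond k i l then opTerm a x q l else 0‖ ≤ ‖opTerm a x q l‖ := by
  split_ifs <;> simp

theorem summable_ite_opTerm (k i : ℕ) {a x q : ℂ} (hq1 : ‖q‖ < 1) (hx : ‖x‖ < 1) :
    Summable fun l : {l // IsOverpartition l} =>
      if BCond k i l.1 then opTerm a x q l.1 else 0 :=
  (summable_opTerm_norm hq1 hx).of_norm_bounded fun l => norm_ite_opTerm_le k i a x q l.1

theorem bSum_eq_sum {k i : ℕ} (hi : 1 ≤ i) (hik : i ≤ k) {a x q : ℂ} (hq1 : ‖q‖ < 1)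
    (hx : ‖x‖ < 1) :
    bSum k i a x q =
      ∑ m ∈ Finset.range i, (x * q) ^ m * bSum k (k - m) a (x * q) q +
        a * (x * q) * ∑ m ∈ Finset.range (i - 1), (x * q) ^ m * bSum k (k - m) a (x * q) q := by
  have hs := (glueOnesEquiv.summable_iff (f := fun l : {l // IsOverpartition l} =>
      if BCond k i l.1 then opTerm a x q l.1 else 0)).2 (summable_ite_opTerm k i hq1 hx)
  have hterm : ∀ t : {l // IsOverpartition l} × ℕ × Bool,
      (if BCond k i (glueOnesEquiv t).1 then opTerm a x q (glueOnesEquiv t).1 else 0) =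
        if t.2.1 + t.2.2.toNat < i then a ^ t.2.2.toNat * (x * q) ^ (t.2.1 + t.2.2.toNat) *
          (if BCond k (k - t.2.1) t.1.1 then opTerm a (x * q) q t.1.1 else 0) else 0 := by
    intro t
    rw [coe_glueOnesEquiv]
    simp only [bCond_glueOnes_iff hi hik t.1.2, opTerm_glueOnes, ite_and, mul_ite, mul_zero]
  have hcomp : ((fun l : {l // IsOverpartition l} =>
      if BCond k i l.1 then opTerm a x q l.1 else 0) ∘ glueOnesEquiv) = fun t =>
        if t.2.1 + t.2.2.toNat < i then a ^ t.2.2.toNat * (x * q) ^ (t.2.1 + t.2.2.toNat) *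
          (if BCond k (k - t.2.1) t.1.1 then opTerm a (x * q) q t.1.1 else 0) else 0 :=
    funext hterm
  rw [hcomp] at hs
  have hfiber : ∀ c : ℕ × Bool, (∑' l : {l // IsOverpartition l},
      if c.1 + c.2.toNat < i then a ^ c.2.toNat * (x * q) ^ (c.1 + c.2.toNat) *
          (if BCond k (k - c.1) l.1 then opTerm a (x * q) q l.1 else 0) else 0) =
      if c.1 + c.2.toNat < i then a ^ c.2.toNat * (x * q) ^ (c.1 + c.2.toNat) *
        bSum k (k - c.1) a (x * q) q else 0 := by
    intro c
    split_ifs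
    · rw [tsum_mul_left, bSum]
    · exact tsum_zero
  have hs' := (Equiv.prodComm _ _).summable_iff.2 hs
  calc bSum k i a x q
      = ∑' c : ℕ × Bool, ∑' l : {l // IsOverpartition l},
        if c.1 + c.2.toNat < i then a ^ c.2.toNat * (x * q) ^ (c.1 + c.2.toNat) *
          (if BCond k (k - c.1) l.1 then opTerm a (x * q) q l.1 else 0) else 0 := by
        rw [bSum, ← glueOnesEquiv.tsum_eq, tsum_congr hterm, ← (Equiv.prodComm _ _).tsum_eq]
        exact hs'.tsum_prod
    _ = ∑ c ∈ Finset.range i ×ˢ (Finset.univ : Finset Bool),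
        if c.1 + c.2.toNat < i then a ^ c.2.toNat * (x * q) ^ (c.1 + c.2.toNat) *
          bSum k (k - c.1) a (x * q) q else 0 := by
        rw [tsum_congr hfiber]
        refine tsum_eq_sum fun c hc => if_neg fun h => hc ?_
        simp only [Finset.mem_product, Finset.mem_range, Finset.mem_univ, and_true]
        omega
    _ = _ := by
        rw [Finset.sum_product]
        simp only [Fintype.sum_bool, Bool.toNat_true, Bool.toNat_false]
        obtain ⟨i, rfl⟩ : ∃ j, i = j + 1 := ⟨i - 1, by omega⟩
        rw [Finset.sum_add_distrib, add_comm]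
        congr 1
        · refine Finset.sum_congr rfl fun m hm => ?_
          rw [if_pos (by simpa using hm)]
          simp
        · rw [Finset.sum_range_succ, if_neg (by omega), add_zero, Finset.mul_sum]
          refine Finset.sum_congr rfl fun m hm => ?_
          rw [if_pos (by simpa using hm)]
          ring

theorem tendsto_bSum (k i : ℕ) {a x q : ℂ} (hq1 : ‖q‖ < 1)
    (hx : ‖x‖ < 1) :
    Filter.Tendsto (fun N : ℕ => bSum k i a (x * q ^ N) q) Filter.atTop (nhds 1) := by
  have hlim : (1 : ℂ) = ∑' l : {l // IsOverpartition l}, if l.1 = [] then 1 else 0 := by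
    rw [tsum_eq_single ⟨[], isOverpartition_nil⟩]
    · simp
    · intro l hl
      exact if_neg fun h => hl (Subtype.ext h)
  rw [hlim]
  refine tendsto_tsum_of_dominated_convergence (summable_opTerm_norm (a := a) hq1 hx) ?_ ?_
  · intro l
    by_cases hl : l.1 = []
    · have hB : BCond k i [] := ⟨isOverpartition_nil, fun m hm => by simp at hm, by simp⟩
      simp [hl, hB, opTerm, opOverlined, opWeight]
    · have hlen : l.1.length ≠ 0 := by simpa using hl
      simp only [if_neg hl]
      split_ifs
      · have hq : Filter.Tendsto (fun N : ℕ => x * q ^ N) Filter.atTop (nhds 0) := by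
          simpa using (tendsto_pow_atTop_nhds_zero_of_norm_lt_one hq1).const_mul x
        have := ((hq.pow l.1.length).const_mul (a ^ opOverlined l.1)).mul_const (q ^ opWeight l.1)
        simpa [opTerm, hlen] using this
      · exact tendsto_const_nhds
  · refine Filter.Eventually.of_forall fun N l => (norm_ite_opTerm_le _ _ _ _ _ _).trans ?_
    rw [norm_opTerm, norm_opTerm]
    have : ‖x * q ^ N‖ ≤ ‖x‖ := by
      rw [norm_mul, norm_pow]
      exact mul_le_of_le_one_right (norm_nonneg _) (pow_le_one₀ (norm_nonneg _) hq1.le)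
    unfold opTerm
    gcongr

theorem tsum_comp_eq_tsum_card_fiber {α β : Type*} (s : α → β) (g : β → ℂ)
    (h : Summable fun c => g (s c)) :
    ∑' c, g (s c) = ∑' t, (Nat.card {c // s c = t} : ℂ) * g t := by
  rw [← (Equiv.sigmaFiberEquiv s).tsum_eq]
  have h' : Summable fun c => g (s (Equiv.sigmaFiberEquiv s c)) :=
    (Equiv.sigmaFiberEquiv s).summable_iff.2 h
  rw [h'.tsum_sigma]
  refine tsum_congr fun t => ?_
  rw [← nsmul_eq_mul, ← tsum_const]
  exact tsum_congr fun c => congrArg g c.2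

theorem tsum_subtype_bCond_opTerm (k i : ℕ) (a x q : ℂ) :
    ∑' l : {l : List (ℕ × Bool) // BCond k i l}, opTerm a x q l.1 = bSum k i a x q := by
  have hinj : Function.Injective fun l : {l : List (ℕ × Bool) // BCond k i l} =>
      (⟨l.1, l.2.1⟩ : {l // IsOverpartition l}) :=
    fun l l' h => Subtype.ext (by simpa using h)
  rw [bSum, ← hinj.tsum_eq]
  · exact tsum_congr fun l => (if_pos l.2).symm
  · intro l hl
    have hB : BCond k i l.1 := by
      by_contra hB
      exact hl (if_neg hB)
    exact ⟨⟨l.1, hB⟩, rfl⟩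

theorem summable_opTerm {a x q : ℂ} (hq1 : ‖q‖ < 1) (hx : ‖x‖ < 1) :
    Summable fun l : {l // IsOverpartition l} => opTerm a x q l.1 :=
  (summable_opTerm_norm hq1 hx).of_norm

theorem summable_subtype_bCond (k i : ℕ) {f : List (ℕ × Bool) → ℂ}
    (h : Summable fun l : {l // IsOverpartition l} => f l.1) :
    Summable fun l : {l : List (ℕ × Bool) // BCond k i l} => f l.1 := by
  have hinj : Function.Injective fun l : {l : List (ℕ × Bool) // BCond k i l} =>
      (⟨l.1, l.2.1⟩ : {l // IsOverpartition l}) :=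
    fun l l' h => Subtype.ext (by simpa using h)
  exact h.comp_injective hinj

theorem bbarP_eq_card_fiber (k i : ℕ) (t : ℕ × ℕ × ℕ) :
    BbarP k i t.1 t.2.1 t.2.2 = Nat.card {l : {l : List (ℕ × Bool) // BCond k i l} //
      (opWeight l.1, opOverlined l.1, l.1.length) = t} := by
  refine Nat.card_congr ⟨fun l => ⟨⟨l.1, l.2.1⟩, ?_⟩, fun l => ⟨l.1.1, l.1.2, ?_⟩,
    fun _ => rfl, fun _ => rfl⟩
  · obtain ⟨h1, h2, h3⟩ := l.2.2
    exact Prod.ext h1 (Prod.ext h2 h3)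
  · simp [← l.2]

theorem tsum_bbarP_eq_bSum (k i : ℕ) {a x q : ℂ} (hq1 : ‖q‖ < 1) (hx : ‖x‖ < 1) :
    ∑' t : ℕ × ℕ × ℕ, (BbarP k i t.1 t.2.1 t.2.2 : ℂ) * a ^ t.2.1 * x ^ t.2.2 * q ^ t.1 =
      bSum k i a x q := by
  have hsum := summable_subtype_bCond k i (summable_opTerm (a := a) hq1 hx)
  have hfiber := tsum_comp_eq_tsum_card_fiber
    (fun l : {l : List (ℕ × Bool) // BCond k i l} => (opWeight l.1, opOverlined l.1, l.1.length))
    (fun t => a ^ t.2.1 * x ^ t.2.2 * q ^ t.1) hsum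
  rw [← tsum_subtype_bCond_opTerm]
  refine Eq.trans (tsum_congr fun t => ?_) hfiber.symm
  rw [bbarP_eq_card_fiber]
  ring

theorem multipliable_one_sub_mul_pow (x : ℂ) {q : ℂ} (hq1 : ‖q‖ < 1) :
    Multipliable fun n : ℕ => 1 - x * q ^ n := by
  have hs : Summable fun n : ℕ => ‖-(x * q ^ n)‖ := by
    simpa using (summable_geometric_of_lt_one (norm_nonneg q) hq1).mul_left ‖x‖
  simpa [sub_eq_add_neg] using multipliable_one_add_of_summable hs

theorem qPochN_mul_qPochInf (x : ℂ) {q : ℂ} (hq1 : ‖q‖ < 1) (n : ℕ) :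
    qPochN x q n * qPochInf (x * q ^ n) q = qPochInf x q := by
  have h := Multipliable.prod_mul_tprod_nat_mul' (f := fun n : ℕ => 1 - x * q ^ n) (k := n) (by
    simpa [pow_add, mul_comm, mul_left_comm, mul_assoc] using
      multipliable_one_sub_mul_pow (x * q ^ n) hq1)
  rw [qPochN, qPochInf, qPochInf, ← h]
  congr 2
  funext m
  ring

theorem qPochInf_eq_one_sub_mul (x : ℂ) {q : ℂ} (hq1 : ‖q‖ < 1) :
    qPochInf x q = (1 - x) * qPochInf (x * q) q := by
  simpa [qPochN] using (qPochN_mul_qPochInf x hq1 1).symm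

theorem norm_mul_pow_lt_one {x q : ℂ} (hq1 : ‖q‖ < 1) (hx : ‖x‖ < 1) (n : ℕ) :
    ‖x * q ^ n‖ < 1 := by
  rw [norm_mul, norm_pow]
  exact (mul_le_of_le_one_right (norm_nonneg _) (pow_le_one₀ (norm_nonneg _) hq1.le)).trans_lt hx

theorem one_sub_ne_zero_of_norm_lt_one {z : ℂ} (hz : ‖z‖ < 1) : 1 - z ≠ 0 := by
  intro h
  rw [← sub_eq_zero.1 h] at hz
  simp at hz

theorem qPochInf_ne_zero {x q : ℂ} (hq1 : ‖q‖ < 1) (hx : ‖x‖ < 1) : qPochInf x q ≠ 0 := by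
  have hs : Summable fun n : ℕ => ‖-(x * q ^ n)‖ := by
    simpa using (summable_geometric_of_lt_one (norm_nonneg q) hq1).mul_left ‖x‖
  have h := tprod_one_add_ne_zero_of_summable (f := fun n : ℕ => -(x * q ^ n)) (fun n => by
    simpa [sub_eq_add_neg] using
      one_sub_ne_zero_of_norm_lt_one (norm_mul_pow_lt_one hq1 hx n)) hs
  simpa [qPochInf, sub_eq_add_neg] using h

theorem tendsto_mul_pow_nhds_zero (x : ℂ) {q : ℂ} (hq1 : ‖q‖ < 1) :
    Filter.Tendsto (fun n : ℕ => x * q ^ n) Filter.atTop (nhds 0) := by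
  simpa using (tendsto_pow_atTop_nhds_zero_of_norm_lt_one hq1).const_mul x

theorem tendsto_qPochInf (x : ℂ) {q : ℂ} (hq1 : ‖q‖ < 1) :
    Filter.Tendsto (fun n : ℕ => qPochInf (x * q ^ n) q) Filter.atTop (nhds 1) := by
  have main : ∀ y : ℂ, ‖y‖ < 1 →
      Filter.Tendsto (fun n : ℕ => qPochInf (y * q ^ n) q) Filter.atTop (nhds 1) := by
    intro y hy
    have hne := qPochInf_ne_zero hq1 hy
    have hN : Filter.Tendsto (fun n => qPochN y q n) Filter.atTop (nhds (qPochInf y q)) :=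
      (multipliable_one_sub_mul_pow y hq1).hasProd.tendsto_prod_nat
    have h := (tendsto_const_nhds (x := qPochInf y q)).div hN hne
    rw [div_self hne] at h
    refine h.congr fun n => ?_
    have hmul := qPochN_mul_qPochInf y hq1 n
    have hn0 : qPochN y q n ≠ 0 := fun h0 => hne (by rw [← hmul, h0, zero_mul])
    change qPochInf y q / qPochN y q n = _
    rw [← hmul, mul_div_cancel_left₀ _ hn0]
  have hlt := (tendsto_mul_pow_nhds_zero x hq1).norm.eventually (gt_mem_nhds (by simp :
    ‖(0 : ℂ)‖ < 1))
  obtain ⟨M, hM⟩ := hlt.exists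
  rw [← Filter.tendsto_add_atTop_iff_nat M]
  refine (main _ hM).congr fun n => ?_
  rw [pow_add]
  ring_nf

theorem exists_norm_le_of_tendsto {u : ℕ → ℂ} {l : ℂ} (h : Filter.Tendsto u Filter.atTop (nhds l)) :
    ∃ C, ∀ n, ‖u n‖ ≤ C := by
  obtain ⟨C, hC⟩ := (Metric.isBounded_range_of_tendsto u h).exists_norm_le
  exact ⟨C, fun n => hC _ ⟨n, rfl⟩⟩

/-- The part of the summand of `Hgf` not involving the factor `1 - xⁱ q^{2ni}`. -/
noncomputable def hCore (k i : ℕ) (a x q : ℂ) (n : ℕ) : ℂ :=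
  x ^ (k * n) * q ^ ((k : ℤ) * (n : ℤ) ^ 2 + (n : ℤ) - (i : ℤ) * (n : ℤ)) *
    a ^ n * qPochInf (a * x * q ^ (n + 1)) q *
    qPochN (1 / a) q n / (qPochN q q n * qPochInf (x * q ^ n) q)

theorem hgf_eq_tsum_hCore (k i : ℕ) (a x q : ℂ) :
    Hgf k i a x q = ∑' n : ℕ, hCore k i a x q n * (1 - x ^ i * q ^ (2 * n * i)) := by
  refine tsum_congr fun n => ?_
  rw [hCore]
  ring

theorem norm_pow_mul_qPochN_le {a q : ℂ} (ha : a ≠ 0) (hq1 : ‖q‖ < 1) (n : ℕ) :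
    ‖a ^ n * qPochN (1 / a) q n‖ ≤ (‖a‖ + 1) ^ n := by
  have h : a ^ n * qPochN (1 / a) q n = ∏ j ∈ Finset.range n, (a - q ^ j) := by
    rw [qPochN, ← Finset.card_range n, ← Finset.prod_const, Finset.card_range,
      ← Finset.prod_mul_distrib]
    refine Finset.prod_congr rfl fun j _ => ?_
    field_simp
  rw [h]
  calc _ ≤ ∏ j ∈ Finset.range n, (‖a‖ + 1) := by
        rw [norm_prod]
        gcongr with j
        refine (norm_sub_le _ _).trans ?_
        gcongr
        rw [norm_pow]
        exact pow_le_one₀ (norm_nonneg _) hq1.le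
    _ = _ := by simp

theorem norm_inv_qPochN_self_le {q : ℂ} (hq1 : ‖q‖ < 1) (n : ℕ) :
    ‖(qPochN q q n)⁻¹‖ ≤ ((1 - ‖q‖)⁻¹) ^ n := by
  have h0 : 0 < 1 - ‖q‖ := by linarith
  rw [norm_inv, qPochN, norm_prod, ← Finset.prod_inv_distrib]
  calc _ ≤ ∏ j ∈ Finset.range n, (1 - ‖q‖)⁻¹ := by
        gcongr with j
        have h1 : ‖q * q ^ j‖ ≤ ‖q‖ := by
          rw [norm_mul, norm_pow]
          exact mul_le_of_le_one_right (norm_nonneg _) (pow_le_one₀ (norm_nonneg _) hq1.le)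
        have h2 := norm_sub_norm_le (1 : ℂ) (q * q ^ j)
        rw [norm_one] at h2
        linarith
    _ = _ := by simp

theorem norm_zpow_le_pow_sq {k i : ℕ} (hk : 1 ≤ k) (hik : i ≤ k) {q : ℂ} (hq0 : 0 < ‖q‖)
    (hq1 : ‖q‖ < 1) (n : ℕ) :
    ‖q ^ ((k : ℤ) * (n : ℤ) ^ 2 + (n : ℤ) - (i : ℤ) * (n : ℤ))‖ ≤ ‖q‖ ^ (n ^ 2) := by
  rw [norm_zpow, ← zpow_natCast]
  refine zpow_le_zpow_right_of_le_one₀ hq0 hq1.le ?_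
  push_cast
  have hn : (n : ℤ) ≤ (n : ℤ) ^ 2 := by exact_mod_cast Nat.le_self_pow (by norm_num) n
  have hk' : (1 : ℤ) ≤ k := by exact_mod_cast hk
  have hik' : (i : ℤ) ≤ k := by exact_mod_cast hik
  have hn0 : (0 : ℤ) ≤ n := by positivity
  nlinarith [mul_nonneg (sub_nonneg.2 hk') (sub_nonneg.2 hn), mul_nonneg (sub_nonneg.2 hik') hn0]

theorem summable_pow_mul_pow_sq {R Q : ℝ} (hR : 0 < R) (hQ0 : 0 < Q) (hQ1 : Q < 1) :
    Summable fun n : ℕ => R ^ n * Q ^ (n ^ 2) := by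
  refine summable_of_ratio_test_tendsto_lt_one (l := 0) zero_lt_one
    (Filter.Eventually.of_forall fun n => by positivity) ?_
  have h : Filter.Tendsto (fun n : ℕ => R * Q * (Q ^ 2) ^ n) Filter.atTop (nhds 0) := by
    simpa using (tendsto_pow_atTop_nhds_zero_of_lt_one (sq_nonneg Q)
      (by nlinarith : Q ^ 2 < 1)).const_mul (R * Q)
  refine h.congr fun n => ?_
  rw [Real.norm_of_nonneg (by positivity), Real.norm_of_nonneg (by positivity)]
  rw [eq_div_iff (by positivity)]
  ring

theorem exists_norm_hCore_le (k i : ℕ) (hk : 1 ≤ k) (hik : i ≤ k) {a x q : ℂ} (ha : a ≠ 0)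
    (hq0 : 0 < ‖q‖) (hq1 : ‖q‖ < 1) (hx : ‖x‖ < 1) :
    ∃ b : ℕ → ℝ, Summable b ∧ ∀ N n, ‖hCore k i a (x * q ^ N) q n‖ ≤ b n := by
  obtain ⟨C, hC⟩ := exists_norm_le_of_tendsto (tendsto_qPochInf (a * x) hq1)
  obtain ⟨D, hD⟩ := exists_norm_le_of_tendsto ((tendsto_qPochInf x hq1).inv₀ one_ne_zero)
  have hC0 : 0 ≤ C := (norm_nonneg _).trans (hC 0)
  have h1q : 0 < 1 - ‖q‖ := by linarith
  refine ⟨fun n => C * D * (((‖a‖ + 1) * (1 - ‖q‖)⁻¹) ^ n * ‖q‖ ^ (n ^ 2)),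
    (summable_pow_mul_pow_sq (by positivity) hq0 hq1).mul_left _, fun N n => ?_⟩
  have hsplit : hCore k i a (x * q ^ N) q n =
      (x * q ^ N) ^ (k * n) * q ^ ((k : ℤ) * (n : ℤ) ^ 2 + (n : ℤ) - (i : ℤ) * (n : ℤ)) *
        (a ^ n * qPochN (1 / a) q n) * qPochInf (a * x * q ^ (N + n + 1)) q *
        (qPochN q q n)⁻¹ * (qPochInf (x * q ^ (N + n)) q)⁻¹ := by
    have e1 : a * (x * q ^ N) * q ^ (n + 1) = a * x * q ^ (N + n + 1) := by ring
    have e2 : x * q ^ N * q ^ n = x * q ^ (N + n) := by ring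
    rw [hCore, e1, e2, div_eq_mul_inv, mul_inv]
    ring
  have hpow : ‖(x * q ^ N) ^ (k * n)‖ ≤ 1 := by
    rw [norm_pow]
    exact pow_le_one₀ (norm_nonneg _) (norm_mul_pow_lt_one hq1 hx N).le
  rw [hsplit]
  simp only [norm_mul _ (qPochInf _ _)⁻¹, norm_mul _ (qPochN q q n)⁻¹,
    norm_mul _ (qPochInf (a * x * q ^ (N + n + 1)) q), norm_mul _ (a ^ n * qPochN (1 / a) q n),
    norm_mul _ (q ^ ((k : ℤ) * (n : ℤ) ^ 2 + (n : ℤ) - (i : ℤ) * (n : ℤ)))]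
  calc _ ≤ 1 * ‖q‖ ^ (n ^ 2) * (‖a‖ + 1) ^ n * C * ((1 - ‖q‖)⁻¹) ^ n * D := by
        gcongr
        · exact norm_zpow_le_pow_sq hk hik hq0 hq1 n
        · exact norm_pow_mul_qPochN_le ha hq1 n
        · exact hC _
        · exact norm_inv_qPochN_self_le hq1 n
        · exact hD _
    _ = _ := by
        rw [mul_pow]
        ring

theorem norm_one_sub_le_two {z : ℂ} (hz : ‖z‖ ≤ 1) : ‖1 - z‖ ≤ 2 := by
  have := norm_sub_le 1 z
  rw [norm_one] at this
  linarith

theorem norm_pow_mul_pow_le_one {x q : ℂ} (hq1 : ‖q‖ < 1) (hx : ‖x‖ < 1) (i m : ℕ) :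
    ‖x ^ i * q ^ m‖ ≤ 1 := by
  rw [norm_mul, norm_pow, norm_pow]
  exact mul_le_one₀ (pow_le_one₀ (norm_nonneg _) hx.le) (by positivity)
    (pow_le_one₀ (norm_nonneg _) hq1.le)

theorem summable_hCore_mul {k i : ℕ} (hk : 1 ≤ k) (hik : i ≤ k) {a x q : ℂ} (ha : a ≠ 0)
    (hq0 : 0 < ‖q‖) (hq1 : ‖q‖ < 1) (hx : ‖x‖ < 1) {z : ℕ → ℂ} (hz : ∀ n, ‖z n‖ ≤ 1) :
    Summable fun n => hCore k i a x q n * (1 - z n) := by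
  obtain ⟨b, hb, hle⟩ := exists_norm_hCore_le k i hk hik ha hq0 hq1 hx
  refine (hb.mul_right 2).of_norm_bounded fun n => ?_
  rw [norm_mul]
  have h1 := hle 0 n
  rw [pow_zero, mul_one] at h1
  exact mul_le_mul h1 (norm_one_sub_le_two (hz n)) (norm_nonneg _) ((norm_nonneg _).trans h1)

theorem tendsto_hgf {k i : ℕ} (hi : 1 ≤ i) (hik : i ≤ k) {a x q : ℂ} (ha : a ≠ 0)
    (hq0 : 0 < ‖q‖) (hq1 : ‖q‖ < 1) (hx : ‖x‖ < 1) :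
    Filter.Tendsto (fun N : ℕ => Hgf k i a (x * q ^ N) q) Filter.atTop (nhds 1) := by
  obtain ⟨b, hb, hle⟩ := exists_norm_hCore_le k i (hi.trans hik) hik ha hq0 hq1 hx
  have hlim : (1 : ℂ) = ∑' n : ℕ, if n = 0 then 1 else 0 := by simp
  rw [hlim]
  simp only [hgf_eq_tsum_hCore]
  refine tendsto_tsum_of_dominated_convergence (hb.mul_right 2) ?_ ?_
  · intro n
    have hxq := tendsto_mul_pow_nhds_zero x hq1
    have hfac : Filter.Tendsto (fun N : ℕ => 1 - (x * q ^ N) ^ i * q ^ (2 * n * i)) Filter.atTop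
        (nhds 1) := by
      have h := ((hxq.pow i).mul_const (q ^ (2 * n * i))).const_sub 1
      rwa [zero_pow (by omega), zero_mul, sub_zero] at h
    have hnum : Filter.Tendsto (fun N : ℕ => qPochInf (a * (x * q ^ N) * q ^ (n + 1)) q)
        Filter.atTop (nhds 1) := by
      refine (tendsto_qPochInf (a * x * q ^ (n + 1)) hq1).congr fun N => ?_
      ring_nf
    have hden : Filter.Tendsto (fun N : ℕ => qPochInf (x * q ^ N * q ^ n) q)
        Filter.atTop (nhds 1) := by
      refine (tendsto_qPochInf (x * q ^ n) hq1).congr fun N => ?_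
      ring_nf
    have hne : ∀ m, qPochN q q m ≠ 0 := fun m => Finset.prod_ne_zero_iff.2 fun j _ =>
      one_sub_ne_zero_of_norm_lt_one (norm_mul_pow_lt_one hq1 hq1 j)
    have hcore := ((((((hxq.pow (k * n)).mul_const
      (q ^ ((k : ℤ) * (n : ℤ) ^ 2 + (n : ℤ) - (i : ℤ) * (n : ℤ)))).mul_const (a ^ n)).mul
        hnum).mul_const (qPochN (1 / a) q n)).div (hden.const_mul (qPochN q q n))
          (by simpa using hne n)).mul hfac
    rcases Nat.eq_zero_or_pos n with rfl | hn
    · simpa [hCore, qPochN] using hcore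
    · have hkn : k * n ≠ 0 := by
        have := Nat.mul_pos (by omega : 0 < k) hn
        omega
      rw [zero_pow hkn] at hcore
      simpa [hCore, hn.ne'] using hcore
  · refine Filter.Eventually.of_forall fun N n => ?_
    rw [norm_mul]
    exact mul_le_mul (hle N n) (norm_one_sub_le_two (norm_pow_mul_pow_le_one hq1
      (norm_mul_pow_lt_one hq1 hx N) _ _)) (norm_nonneg _) ((norm_nonneg _).trans (hle N n))

theorem hCore_eq_mul_pow (k i : ℕ) (a x : ℂ) {q : ℂ} (hq : q ≠ 0) (n : ℕ) :
    hCore k i a x q n = hCore k (i + 1) a x q n * q ^ n := by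
  have h : q ^ ((k : ℤ) * (n : ℤ) ^ 2 + (n : ℤ) - (i : ℤ) * (n : ℤ)) =
      q ^ ((k : ℤ) * (n : ℤ) ^ 2 + (n : ℤ) - ((i + 1 : ℕ) : ℤ) * (n : ℤ)) * q ^ n := by
    rw [← zpow_natCast, ← zpow_add₀ hq]
    congr 1
    push_cast
    ring
  rw [hCore, hCore, h]
  ring

theorem zpow_quadratic_eq_div (k i n : ℕ) {q : ℂ} (hq : q ≠ 0) :
    q ^ ((k : ℤ) * (n : ℤ) ^ 2 + (n : ℤ) - (i : ℤ) * (n : ℤ)) =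
      q ^ (k * n ^ 2 + n) / q ^ (i * n) := by
  rw [zpow_sub₀ hq]
  norm_cast

/-- The termwise identity behind the functional equation of `Hgf`. -/
theorem hCore_recurrence (j d : ℕ) {a x q : ℂ} (ha : a ≠ 0) (hq : q ≠ 0) (hq1 : ‖q‖ < 1)
    (hx : ‖x‖ < 1) (n : ℕ) :
    x ^ j * (hCore (j + d + 1) (d + 1) a (x * q) q n *
        (1 - (x * q) ^ (d + 1) * q ^ (2 * n * (d + 1))) -
      a * x * q * (hCore (j + d + 1) d a (x * q) q n * (1 - (x * q) ^ d * q ^ (2 * n * d)))) =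
    hCore (j + d + 1) (j + 1) a x q (n + 1) * (1 - q ^ (n + 1)) +
      hCore (j + d + 1) (j + 1) a x q n * (x ^ j * q ^ (2 * n * j + n) * (1 - x * q ^ n)) := by
  rw [hCore_eq_mul_pow _ d _ _ hq]
  simp only [hCore]
  rw [zpow_quadratic_eq_div _ _ _ hq, zpow_quadratic_eq_div _ _ _ hq,
    zpow_quadratic_eq_div _ _ _ hq]
  have e1 : a * (x * q) * q ^ (n + 1) = a * x * q ^ (n + 1 + 1) := by ring
  have e2 : x * q * q ^ n = x * q ^ (n + 1) := by ring
  have e3 : qPochInf (a * x * q ^ (n + 1)) q =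
      (1 - a * x * q ^ (n + 1)) * qPochInf (a * x * q ^ (n + 1 + 1)) q := by
    rw [qPochInf_eq_one_sub_mul _ hq1]
    ring_nf
  have e4 : qPochInf (x * q ^ n) q = (1 - x * q ^ n) * qPochInf (x * q ^ (n + 1)) q := by
    rw [qPochInf_eq_one_sub_mul _ hq1]
    ring_nf
  have e5 : qPochN (1 / a) q (n + 1) = qPochN (1 / a) q n * (1 - 1 / a * q ^ n) :=
    Finset.prod_range_succ _ _
  have e6 : qPochN q q (n + 1) = qPochN q q n * (1 - q ^ (n + 1)) := by
    rw [qPochN, Finset.prod_range_succ, pow_succ', qPochN]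
  rw [e1, e2, e3, e4, e5, e6]
  have hD : qPochInf (x * q ^ (n + 1)) q ≠ 0 :=
    qPochInf_ne_zero hq1 (norm_mul_pow_lt_one hq1 hx _)
  have hxn : 1 - x * q ^ n ≠ 0 := one_sub_ne_zero_of_norm_lt_one (norm_mul_pow_lt_one hq1 hx _)
  have hV : qPochN q q n ≠ 0 := Finset.prod_ne_zero_iff.2 fun j _ =>
    one_sub_ne_zero_of_norm_lt_one (norm_mul_pow_lt_one hq1 hq1 j)
  have hqn : 1 - q ^ (n + 1) ≠ 0 := by
    rw [pow_succ']
    exact one_sub_ne_zero_of_norm_lt_one (norm_mul_pow_lt_one hq1 hq1 n)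
  generalize qPochInf (x * q ^ (n + 1)) q = D at *
  generalize qPochInf (a * x * q ^ (n + 1 + 1)) q = P at *
  generalize qPochN q q n = V at *
  generalize qPochN (1 / a) q n = W at *
  field_simp
  ring

theorem hgf_zero (k : ℕ) (a x q : ℂ) : Hgf k 0 a x q = 0 := by
  simp [Hgf]

theorem hgf_sub_hgf (j d : ℕ) {a x q : ℂ} (ha : a ≠ 0) (hq0 : 0 < ‖q‖) (hq1 : ‖q‖ < 1)
    (hx : ‖x‖ < 1) :
    Hgf (j + d + 1) (j + 1) a x q - Hgf (j + d + 1) j a x q =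
      x ^ j * Jgf (j + d + 1) (d + 1) a x q := by
  have hq : q ≠ 0 := norm_pos_iff.1 hq0
  have hterm : ∀ (y : ℂ), ‖y‖ < 1 → ∀ i ≤ j + d + 1, Summable fun n =>
      hCore (j + d + 1) i a y q n * (1 - y ^ i * q ^ (2 * n * i)) := fun y hy i hik =>
    summable_hCore_mul (by omega) hik ha hq0 hq1 hy fun n => norm_pow_mul_pow_le_one hq1 hy _ _
  have hxq : ‖x * q‖ < 1 := by simpa using norm_mul_pow_lt_one hq1 hx 1
  have hu : Summable fun n => hCore (j + d + 1) (j + 1) a x q n * (1 - q ^ n) :=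
    summable_hCore_mul (by omega) (by omega) ha hq0 hq1 hx fun n => by
      simpa using norm_pow_mul_pow_le_one hq1 hx 0 n
  have hu0 := hu.tsum_eq_zero_add
  rw [pow_zero, sub_self, mul_zero, zero_add] at hu0
  have hu1 := (summable_nat_add_iff 1).2 hu
  have hv := ((hterm x hx (j + 1) (by omega)).sub (hterm x hx j (by omega))).sub hu
  have hsum : ∀ n, x ^ j * (hCore (j + d + 1) (d + 1) a (x * q) q n *
        (1 - (x * q) ^ (d + 1) * q ^ (2 * n * (d + 1))) -
      a * x * q * (hCore (j + d + 1) d a (x * q) q n * (1 - (x * q) ^ d * q ^ (2 * n * d)))) =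
      hCore (j + d + 1) (j + 1) a x q (n + 1) * (1 - q ^ (n + 1)) +
      (hCore (j + d + 1) (j + 1) a x q n * (1 - x ^ (j + 1) * q ^ (2 * n * (j + 1))) -
        hCore (j + d + 1) j a x q n * (1 - x ^ j * q ^ (2 * n * j)) -
        hCore (j + d + 1) (j + 1) a x q n * (1 - q ^ n)) := by
    intro n
    rw [hCore_recurrence j d ha hq hq1 hx n, hCore_eq_mul_pow _ j _ _ hq]
    ring
  rw [Jgf, Nat.add_sub_cancel]
  simp only [hgf_eq_tsum_hCore]
  rw [← tsum_mul_left, ← (hterm _ hxq (d + 1) (by omega)).tsum_sub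
    ((hterm _ hxq d (by omega)).mul_left _), ← tsum_mul_left, tsum_congr hsum,
    hu1.tsum_add hv, ((hterm x hx (j + 1) (by omega)).sub (hterm x hx j (by omega))).tsum_sub hu,
    (hterm x hx (j + 1) (by omega)).tsum_sub (hterm x hx j (by omega)), hu0]
  ring

theorem hgf_eq_sum_jgf {k i : ℕ} (hik : i ≤ k) {a x q : ℂ} (ha : a ≠ 0) (hq0 : 0 < ‖q‖)
    (hq1 : ‖q‖ < 1) (hx : ‖x‖ < 1) :
    Hgf k i a x q = ∑ m ∈ Finset.range i, x ^ m * Jgf k (k - m) a x q := by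
  induction i with
  | zero => simp [hgf_zero]
  | succ j ih =>
    obtain ⟨d, rfl⟩ := Nat.exists_eq_add_of_lt (Nat.lt_of_succ_le hik)
    rw [Finset.sum_range_succ, ← ih (by omega), show j + d + 1 - j = d + 1 by omega,
      ← hgf_sub_hgf j d ha hq0 hq1 hx]
    ring

theorem jgf_eq_sum {k i : ℕ} (hik : i ≤ k) {a x q : ℂ} (ha : a ≠ 0) (hq0 : 0 < ‖q‖)
    (hq1 : ‖q‖ < 1) (hx : ‖x‖ < 1) :
    Jgf k i a x q = ∑ m ∈ Finset.range i, (x * q) ^ m * Jgf k (k - m) a (x * q) q -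
      a * (x * q) * ∑ m ∈ Finset.range (i - 1), (x * q) ^ m * Jgf k (k - m) a (x * q) q := by
  have hxq : ‖x * q‖ < 1 := by simpa using norm_mul_pow_lt_one hq1 hx 1
  rw [← hgf_eq_sum_jgf hik ha hq0 hq1 hxq, ← hgf_eq_sum_jgf (by omega) ha hq0 hq1 hxq, Jgf]
  ring

theorem tendsto_jgf {k i : ℕ} (hi : 1 ≤ i) (hik : i ≤ k) {a x q : ℂ} (ha : a ≠ 0)
    (hq0 : 0 < ‖q‖) (hq1 : ‖q‖ < 1) (hx : ‖x‖ < 1) :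
    Filter.Tendsto (fun N : ℕ => Jgf k i a (x * q ^ N) q) Filter.atTop (nhds 1) := by
  have hxq : ‖x * q‖ < 1 := by simpa using norm_mul_pow_lt_one hq1 hx 1
  have hsecond : Filter.Tendsto
      (fun N : ℕ => a * (x * q * q ^ N) * Hgf k (i - 1) a (x * q * q ^ N) q)
      Filter.atTop (nhds 0) := by
    rcases Nat.eq_zero_or_pos (i - 1) with h | h
    · simp [h, hgf_zero]
    · simpa using ((tendsto_mul_pow_nhds_zero (x * q) hq1).const_mul a).mul
        (tendsto_hgf h (by omega) ha hq0 hq1 hxq)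
  have h := (tendsto_hgf hi hik ha hq0 hq1 hxq).sub hsecond
  rw [sub_zero] at h
  refine h.congr fun N => ?_
  rw [Jgf, show x * q ^ N * q = x * q * q ^ N by ring]
  ring

/-- A family with `F i N` bounded by `(1 + C rᴺ)` times a common bound for all `F j (N + 1)`,
and tending to zero, vanishes. -/
theorem eq_zero_of_norm_le_one_add_mul {ι : Type*} [Finite ι] {F : ι → ℕ → ℂ} {C r : ℝ}
    (hC : 0 ≤ C) (hr0 : 0 ≤ r) (hr1 : r < 1)
    (hstep : ∀ N M, (∀ j, ‖F j (N + 1)‖ ≤ M) → ∀ i, ‖F i N‖ ≤ (1 + C * r ^ N) * M)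
    (hlim : ∀ j, Filter.Tendsto (F j) Filter.atTop (nhds 0)) (i : ι) : F i 0 = 0 := by
  have hiter : ∀ N M, 0 ≤ M → (∀ j, ‖F j N‖ ≤ M) →
      ∀ i, ‖F i 0‖ ≤ (∏ n ∈ Finset.range N, (1 + C * r ^ n)) * M := by
    intro N
    induction N with
    | zero => intro M _ h; simpa using h
    | succ N ih =>
      intro M hM h i
      rw [Finset.prod_range_succ, mul_assoc]
      exact ih _ (by positivity) (hstep N M h) i
  have hprod : ∀ N, ∏ n ∈ Finset.range N, (1 + C * r ^ n) ≤ Real.exp (C * (1 - r)⁻¹) := by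
    intro N
    calc _ ≤ ∏ n ∈ Finset.range N, Real.exp (C * r ^ n) := by
          gcongr with n
          linarith [Real.add_one_le_exp (C * r ^ n)]
      _ = Real.exp (C * ∑ n ∈ Finset.range N, r ^ n) := by
          rw [← Real.exp_sum, Finset.mul_sum]
      _ ≤ _ := by
          gcongr
          rw [← tsum_geometric_of_lt_one hr0 hr1]
          exact (summable_geometric_of_lt_one hr0 hr1).sum_le_tsum _ fun n _ => by positivity
  have hbound : ∀ ε > 0, ‖F i 0‖ ≤ Real.exp (C * (1 - r)⁻¹) * ε := by
    intro ε hε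
    have hev : ∀ᶠ N in Filter.atTop, ∀ j, ‖F j N‖ < ε := Filter.eventually_all.2 fun j =>
      (hlim j).norm.eventually (gt_mem_nhds (by simpa using hε))
    obtain ⟨N, hN⟩ := hev.exists
    refine (hiter N ε hε.le (fun j => (hN j).le) i).trans ?_
    gcongr
    exact hprod N
  refine norm_le_zero_iff.1 (le_of_forall_pos_le_add fun ε hε => ?_)
  have hE := Real.exp_pos (C * (1 - r)⁻¹)
  have h := hbound (ε / Real.exp (C * (1 - r)⁻¹)) (by positivity)
  rwa [mul_div_cancel₀ _ hE.ne', ← zero_add ε] at h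

theorem norm_sum_pow_mul_le {y : ℂ} (hy : ‖y‖ ≤ 1) {G : ℕ → ℂ} {M : ℝ} {i : ℕ}
    (hG : ∀ m < i, ‖G m‖ ≤ M) : ‖∑ m ∈ Finset.range i, y ^ m * G m‖ ≤ i * M := by
  refine (norm_sum_le_of_le (f := fun m => y ^ m * G m) (n := fun _ => M) _ fun m hm => ?_).trans
    (by simp)
  rw [norm_mul, norm_pow]
  exact (mul_le_of_le_one_left (norm_nonneg _) (pow_le_one₀ (norm_nonneg _) hy)).trans
    (hG m (Finset.mem_range.1 hm))

/-- The recursion shared by the two sides contracts up to a summable error. -/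
theorem norm_sum_add_sum_le {k i : ℕ} (hi : 1 ≤ i) (hik : i ≤ k) {a y : ℂ} (hy : ‖y‖ ≤ 1)
    {G : ℕ → ℂ} {M : ℝ} (hG : ∀ m < k, ‖G m‖ ≤ M) :
    ‖∑ m ∈ Finset.range i, y ^ m * G m + a * y * ∑ m ∈ Finset.range (i - 1), y ^ m * G m‖ ≤
      (1 + k * (1 + ‖a‖) * ‖y‖) * M := by
  obtain ⟨j, rfl⟩ := Nat.exists_eq_add_of_le' hi
  have hM : 0 ≤ M := (norm_nonneg _).trans (hG 0 (by omega))
  have hjk : (j : ℝ) ≤ k := by exact_mod_cast (by omega : j ≤ k)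
  have h0 := hG 0 (by omega)
  have h1 := norm_sum_pow_mul_le hy (i := j) (G := fun m => G (m + 1))
    fun m hm => hG (m + 1) (by omega)
  have h2 := norm_sum_pow_mul_le hy (i := j) fun m hm => hG m (by omega)
  have hsplit : ∑ m ∈ Finset.range (j + 1), y ^ m * G m =
      G 0 + y * ∑ m ∈ Finset.range j, y ^ m * G (m + 1) := by
    rw [Finset.sum_range_succ', pow_zero, one_mul, add_comm, Finset.mul_sum]
    congr 1
    refine Finset.sum_congr rfl fun m _ => ?_
    ring
  rw [Nat.add_sub_cancel, hsplit]
  calc _ ≤ ‖G 0‖ + ‖y‖ * ‖∑ m ∈ Finset.range j, y ^ m * G (m + 1)‖ +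
        ‖a‖ * ‖y‖ * ‖∑ m ∈ Finset.range j, y ^ m * G m‖ := by
        refine (norm_add₃_le).trans ?_
        simp only [norm_mul, le_refl]
    _ ≤ M + ‖y‖ * (k * M) + ‖a‖ * ‖y‖ * (k * M) := by
        gcongr
        · exact h1.trans (by gcongr)
        · exact h2.trans (by gcongr)
    _ = _ := by ring

theorem bSum_eq_jgf {k i : ℕ} (hi : 1 ≤ i) (hik : i ≤ k) {a x q : ℂ} (ha : a ≠ 0)
    (hq0 : 0 < ‖q‖) (hq1 : ‖q‖ < 1) (hx : ‖x‖ < 1) : bSum k i a x q = Jgf k i (-a) x q := by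
  have ha' : -a ≠ 0 := neg_ne_zero.2 ha
  have hxN := norm_mul_pow_lt_one hq1 hx
  have key := eq_zero_of_norm_le_one_add_mul (ι := Finset.Icc 1 k)
    (F := fun j N => bSum k j a (x * q ^ N) q - Jgf k j (-a) (x * q ^ N) q)
    (C := k * (1 + ‖a‖)) (r := ‖q‖) (by positivity) hq0.le hq1 ?_ ?_
    ⟨i, Finset.mem_Icc.2 ⟨hi, hik⟩⟩
  · simpa [sub_eq_zero] using key
  · rintro N M hM ⟨j, hj⟩
    obtain ⟨hj1, hjk⟩ := Finset.mem_Icc.1 hj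
    have hpow : x * q ^ N * q = x * q ^ (N + 1) := by ring
    have hG : ∀ m < k, ‖bSum k (k - m) a (x * q ^ (N + 1)) q -
        Jgf k (k - m) (-a) (x * q ^ (N + 1)) q‖ ≤ M := fun m hm =>
      hM ⟨k - m, Finset.mem_Icc.2 ⟨by omega, by omega⟩⟩
    have hM0 : 0 ≤ M := (norm_nonneg _).trans (hG 0 (by omega))
    have hle := norm_sum_add_sum_le hj1 hjk (a := a) (hxN (N + 1)).le hG
    have hy : ‖x * q ^ (N + 1)‖ ≤ ‖q‖ ^ N := by
      rw [norm_mul, norm_pow]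
      exact (mul_le_of_le_one_left (by positivity) hx.le).trans
        (pow_le_pow_of_le_one hq0.le hq1.le (Nat.le_succ N))
    refine le_trans (le_of_eq ?_) (hle.trans (by gcongr))
    rw [bSum_eq_sum hj1 hjk hq1 (hxN N), jgf_eq_sum hjk ha' hq0 hq1 (hxN N), hpow]
    simp only [mul_sub, Finset.sum_sub_distrib]
    ring_nf
  · rintro ⟨j, hj⟩
    obtain ⟨hj1, hjk⟩ := Finset.mem_Icc.1 hj
    simpa using (tendsto_bSum k j hq1 hx).sub (tendsto_jgf hj1 hjk ha' hq0 hq1 hx)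

/-- **Lemma 5.2.** `𝓑_{k,i}(a,x,q) = J_{k,i}(-a,x,q)` for `1 ≤ i ≤ k`, where
`𝓑_{k,i}(a,x,q) = Σ_{n,j,p} B̄_{k,i}(n,j,p) aʲ xᵖ qⁿ`. -/
theorem B_eq_J (k i : ℕ) (hi : 1 ≤ i) (hik : i ≤ k) (a x q : ℂ)
    (hq0 : 0 < ‖q‖) (hq1 : ‖q‖ < 1) (hx : ‖x‖ < 1) (ha : a ≠ 0) :
    ∑' t : ℕ × ℕ × ℕ, (BbarP k i t.1 t.2.1 t.2.2 : ℂ) * a ^ t.2.1 * x ^ t.2.2 * q ^ t.1 =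
      Jgf k i (-a) x q := by
  rw [tsum_bbarP_eq_bSum k i hq1 hx, bSum_eq_jgf hi hik ha hq0 hq1 hx]

end Paper
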